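/- Let A_1,…,A_m and c be real symmetric n×n matrices, let ε ∈ (0,1), and let ŷ ∈ ℝ^m and ν̂ ∈ ℝ be such that c − ∑_{i≤m} ŷ_i A_i + ν̂·I ⪰ 0. Let T ∈ ℝ^{d×m} be a matrix satisfying ‖TᵀT ŷ − ŷ‖_∞ ≤ ε‖ŷ‖₂. Then λ_min( c − ∑_{i≤m} (TᵀT ŷ)_i A_i + ν̂·I ) ≥ −ε‖ŷ‖₂·‖Aᵀ‖. -/

import Mathlib

open MeasureTheory Pointwise

/-- Euclidean (ℓ2) norm of a vector in ℝ^k. -/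
noncomputable def norm2 {k : ℕ} (x : Fin k → ℝ) : ℝ := Real.sqrt (∑ i, (x i) ^ 2)

/-- Supremum (ℓ∞) norm of a vector in ℝ^k. -/
noncomputable def normInf {k : ℕ} (x : Fin k → ℝ) : ℝ := ⨆ i, |x i|

/-- Standard Euclidean inner product on ℝ^k. -/
def dotp {k : ℕ} (x y : Fin k → ℝ) : ℝ := ∑ i, x i * y i

/-- ℓ2 operator (spectral) norm of a matrix. -/
noncomputable def specNorm {p q : ℕ} (M : Matrix (Fin p) (Fin q) ℝ) : ℝ :=
  ⨆ u : {u : Fin q → ℝ // norm2 u ≤ 1}, norm2 (M.mulVec u.1)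

/-- ‖Aᵀ‖ := sup { ‖∑ i, y i • A i‖₂ : ‖y‖_∞ ≤ 1 }. -/
noncomputable def ATnorm {n m : ℕ} (A : Fin m → Matrix (Fin n) (Fin n) ℝ) : ℝ :=
  ⨆ y : {y : Fin m → ℝ // normInf y ≤ 1}, specNorm (∑ i, y.1 i • A i)

/-- Smallest eigenvalue of a real symmetric matrix, via the Rayleigh quotient. -/
noncomputable def lambdaMin {n : ℕ} (M : Matrix (Fin n) (Fin n) ℝ) : ℝ :=
  ⨅ u : {u : Fin n → ℝ // u ≠ 0}, dotp u.1 (M.mulVec u.1) / (∑ i, (u.1 i) ^ 2)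

/-- Largest eigenvalue of a real symmetric matrix, via the Rayleigh quotient. -/
noncomputable def lambdaMax {n : ℕ} (M : Matrix (Fin n) (Fin n) ℝ) : ℝ :=
  ⨆ u : {u : Fin n → ℝ // u ≠ 0}, dotp u.1 (M.mulVec u.1) / (∑ i, (u.1 i) ^ 2)

/-- Loewner order: X ⪯ Y iff Y - X is positive semidefinite. -/
def PSDle {n : ℕ} (X Y : Matrix (Fin n) (Fin n) ℝ) : Prop := (Y - X).PosSemidef

/-- Frobenius norm of a matrix. -/
noncomputable def frobNorm {n : ℕ} (X : Matrix (Fin n) (Fin n) ℝ) : ℝ :=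
  Real.sqrt (∑ i, ∑ j, (X i j) ^ 2)

/-- A random matrix `T : Ω → ℝ^{d×m}` is a random projection with constants `c, C` if
for every `ε ∈ (0,1)` and `x ∈ ℝ^m`, `(1-ε)‖x‖² ≤ ‖Tx‖² ≤ (1+ε)‖x‖²` holds with
probability at least `1 - c·exp(-C ε² d)`. -/
def IsRandomProjection {Ω : Type*} [MeasurableSpace Ω] (μ : Measure Ω) {d m : ℕ}
    (T : Ω → Matrix (Fin d) (Fin m) ℝ) (c C : ℝ) : Prop :=
  ∀ ε ∈ Set.Ioo (0 : ℝ) 1, ∀ x : Fin m → ℝ,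
    1 - c * Real.exp (-C * ε ^ 2 * d) ≤
      (μ {ω | (1 - ε) * (norm2 x) ^ 2 ≤ (norm2 ((T ω).mulVec x)) ^ 2 ∧
              (norm2 ((T ω).mulVec x)) ^ 2 ≤ (1 + ε) * (norm2 x) ^ 2}).toReal

/-- Gaussian width of a set `S ⊆ ℝ^k`. -/
noncomputable def gaussWidth {k : ℕ} (S : Set (Fin k → ℝ)) : ℝ :=
  ∫ g, (⨆ x : S, dotp g x.1) ∂(Measure.pi fun _ : Fin k => ProbabilityTheory.gaussianReal 0 1)

/-- Radius (w.r.t. the Euclidean norm) of a set `S ⊆ ℝ^k`. -/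
noncomputable def rad2 {k : ℕ} (S : Set (Fin k → ℝ)) : ℝ := ⨆ x : S, norm2 x.1

/-- Diameter (w.r.t. the Euclidean norm) of a set `S ⊆ ℝ^k`. -/
noncomputable def diam2 {k : ℕ} (S : Set (Fin k → ℝ)) : ℝ :=
  ⨆ p : ↥(S ×ˢ S), norm2 (p.1.1 - p.1.2)

theorem norm2_nonneg' {k : ℕ} (x : Fin k → ℝ) : 0 ≤ norm2 x := Real.sqrt_nonneg _

theorem norm2_smul' {k : ℕ} (t : ℝ) (ht : 0 ≤ t) (x : Fin k → ℝ) :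
    norm2 (t • x) = t * norm2 x := by
  unfold norm2
  have : ∑ i, ((t • x) i) ^ 2 = t ^ 2 * ∑ i, (x i) ^ 2 := by
    rw [Finset.mul_sum]
    exact Finset.sum_congr rfl fun i _ => by simp [mul_pow]
  rw [this, Real.sqrt_mul (sq_nonneg t), Real.sqrt_sq ht]

theorem abs_le_norm2 {k : ℕ} (x : Fin k → ℝ) (i : Fin k) : |x i| ≤ norm2 x := by
  unfold norm2
  apply Real.abs_le_sqrt
  exact Finset.single_le_sum (f := fun i => (x i) ^ 2) (fun j _ => sq_nonneg _) (Finset.mem_univ i)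

theorem norm2_le_sum {k : ℕ} (x : Fin k → ℝ) : norm2 x ≤ ∑ i, |x i| := by
  unfold norm2
  apply Real.sqrt_le_iff.2
  refine ⟨Finset.sum_nonneg fun i _ => abs_nonneg _, ?_⟩
  have := Finset.sum_sq_le_sq_sum_of_nonneg (s := Finset.univ) (f := fun i => |x i|)
    (fun i _ => abs_nonneg _)
  simpa using this

theorem abs_le_normInf {k : ℕ} (x : Fin k → ℝ) (i : Fin k) : |x i| ≤ normInf x :=
  le_ciSup (f := fun i => |x i|) (Set.finite_range _).bddAbove i

theorem mulVec_bound {p q : ℕ} (M : Matrix (Fin p) (Fin q) ℝ) (u : Fin q → ℝ)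
    (hu : norm2 u ≤ 1) : norm2 (M.mulVec u) ≤ ∑ i, ∑ j, |M i j| := by
  refine (norm2_le_sum _).trans (Finset.sum_le_sum fun i _ => ?_)
  simp only [Matrix.mulVec, dotProduct]
  refine (Finset.abs_sum_le_sum_abs _ _).trans (Finset.sum_le_sum fun j _ => ?_)
  rw [abs_mul]
  exact mul_le_of_le_one_right (abs_nonneg _) ((abs_le_norm2 u j).trans hu)

theorem norm2_zero' {k : ℕ} : norm2 (0 : Fin k → ℝ) = 0 := by simp [norm2]

theorem normInf_zero' {k : ℕ} : normInf (0 : Fin k → ℝ) = 0 := by simp [normInf]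

theorem specNorm_bound {p q : ℕ} (M : Matrix (Fin p) (Fin q) ℝ) :
    specNorm M ≤ ∑ i, ∑ j, |M i j| := by
  haveI : Nonempty {u : Fin q → ℝ // norm2 u ≤ 1} := ⟨⟨0, by simp [norm2_zero']⟩⟩
  exact ciSup_le fun u => mulVec_bound M u.1 u.2

theorem le_specNorm {p q : ℕ} (M : Matrix (Fin p) (Fin q) ℝ) (u : Fin q → ℝ)
    (hu : norm2 u ≤ 1) : norm2 (M.mulVec u) ≤ specNorm M :=
  le_ciSup (f := fun u : {u : Fin q → ℝ // norm2 u ≤ 1} => norm2 (M.mulVec u.1))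
    ⟨∑ i, ∑ j, |M i j|, by rintro _ ⟨u, rfl⟩; exact mulVec_bound M u.1 u.2⟩ ⟨u, hu⟩

theorem le_ATnorm {n m : ℕ} (A : Fin m → Matrix (Fin n) (Fin n) ℝ) (y : Fin m → ℝ)
    (hy : normInf y ≤ 1) : specNorm (∑ i, y i • A i) ≤ ATnorm A := by
  refine le_ciSup (f := fun y : {y : Fin m → ℝ // normInf y ≤ 1} => specNorm (∑ i, y.1 i • A i))
    ⟨∑ i, ∑ j, ∑ k, |A k i j|, ?_⟩ ⟨y, hy⟩
  rintro _ ⟨y, rfl⟩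
  refine (specNorm_bound _).trans
    (Finset.sum_le_sum fun i _ => Finset.sum_le_sum fun j _ => ?_)
  simp only [Matrix.sum_apply, Matrix.smul_apply, smul_eq_mul]
  refine (Finset.abs_sum_le_sum_abs _ _).trans (Finset.sum_le_sum fun k _ => ?_)
  rw [abs_mul]
  exact mul_le_of_le_one_left (abs_nonneg _) ((abs_le_normInf y.1 k).trans y.2)

theorem specNorm_nonneg' {p q : ℕ} (M : Matrix (Fin p) (Fin q) ℝ) : 0 ≤ specNorm M :=
  (norm2_nonneg' _).trans (le_specNorm M 0 (by simp [norm2_zero']))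

theorem ATnorm_nonneg' {n m : ℕ} (A : Fin m → Matrix (Fin n) (Fin n) ℝ) : 0 ≤ ATnorm A :=
  (specNorm_nonneg' _).trans (le_ATnorm A 0 (by simp [normInf_zero']))

theorem norm2_mulVec_le {p q : ℕ} (M : Matrix (Fin p) (Fin q) ℝ) (u : Fin q → ℝ)
    (hu : 0 < norm2 u) : norm2 (M.mulVec u) ≤ specNorm M * norm2 u := by
  have h := le_specNorm M ((norm2 u)⁻¹ • u)
    (by rw [norm2_smul' _ (inv_nonneg.2 hu.le), inv_mul_cancel₀ hu.ne'])
  rw [Matrix.mulVec_smul, norm2_smul' _ (inv_nonneg.2 hu.le), inv_mul_le_iff₀ hu] at h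
  linarith

theorem key_bound {n m : ℕ} (A : Fin m → Matrix (Fin n) (Fin n) ℝ) (z : Fin m → ℝ) (s : ℝ)
    (hs : 0 ≤ s) (hz : normInf z ≤ s) (u : Fin n → ℝ) (hu : 0 < norm2 u) :
    dotp u ((∑ i, z i • A i).mulVec u) ≤ s * ATnorm A * ∑ i, (u i) ^ 2 := by
  rcases hs.eq_or_lt with rfl | hs
  · have : z = 0 := by
      funext i
      exact abs_nonpos_iff.1 ((abs_le_normInf z i).trans hz)
    subst this
    simp [dotp]
  · have hy : normInf (s⁻¹ • z) ≤ 1 := by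
      refine Real.iSup_le (fun i => ?_) zero_le_one
      rw [Pi.smul_apply, smul_eq_mul, abs_mul, abs_of_pos (inv_pos.2 hs), inv_mul_le_iff₀ hs,
        mul_one]
      exact (abs_le_normInf z i).trans hz
    have e : ∑ i, z i • A i = s • ∑ i, (s⁻¹ • z) i • A i := by
      rw [Finset.smul_sum]
      refine Finset.sum_congr rfl fun i _ => ?_
      rw [smul_smul, Pi.smul_apply, smul_eq_mul, mul_inv_cancel_left₀ hs.ne']
    have h1 := (norm2_mulVec_le (∑ i, (s⁻¹ • z) i • A i) u hu).trans
      (mul_le_mul_of_nonneg_right (le_ATnorm A _ hy) hu.le)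
    have h2 : dotp u ((∑ i, z i • A i).mulVec u) ≤
        norm2 u * norm2 ((∑ i, z i • A i).mulVec u) :=
      Real.sum_mul_le_sqrt_mul_sqrt _ _ _
    have h3 : norm2 ((∑ i, z i • A i).mulVec u) ≤ s * (ATnorm A * norm2 u) := by
      rw [e, Matrix.smul_mulVec, norm2_smul' _ hs.le]
      exact mul_le_mul_of_nonneg_left h1 hs.le
    have h4 : norm2 u * norm2 u = ∑ i, (u i) ^ 2 :=
      Real.mul_self_sqrt (Finset.sum_nonneg fun i _ => sq_nonneg _)
    have h5 := h2.trans (mul_le_mul_of_nonneg_left h3 hu.le)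
    rw [← h4]
    linarith

/-- If c − ∑ ŷᵢAᵢ + ν̂ I ⪰ 0 and ‖TᵀTŷ − ŷ‖_∞ ≤ ε‖ŷ‖₂, then
λ_min(c − ∑ (TᵀTŷ)ᵢ Aᵢ + ν̂ I) ≥ −ε‖ŷ‖₂‖Aᵀ‖. -/
theorem stmt_5 {n m d : ℕ} (A : Fin m → Matrix (Fin n) (Fin n) ℝ)
    (hA : ∀ i, (A i).IsSymm) (c : Matrix (Fin n) (Fin n) ℝ) (hc : c.IsSymm)
    (ε : ℝ) (hε : ε ∈ Set.Ioo (0 : ℝ) 1) (yh : Fin m → ℝ) (νh : ℝ)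
    (hfeas : (c - ∑ i, yh i • A i + νh • (1 : Matrix (Fin n) (Fin n) ℝ)).PosSemidef)
    (T : Matrix (Fin d) (Fin m) ℝ)
    (hT : normInf (T.transpose.mulVec (T.mulVec yh) - yh) ≤ ε * norm2 yh) :
    -(ε * norm2 yh * ATnorm A) ≤
      lambdaMin (c - ∑ i, (T.transpose.mulVec (T.mulVec yh)) i • A i +
        νh • (1 : Matrix (Fin n) (Fin n) ℝ)) := by
  have hs : 0 ≤ ε * norm2 yh := mul_nonneg hε.1.le (norm2_nonneg' _)
  refine Real.le_iInf (fun u => ?_) (neg_nonpos.2 (mul_nonneg hs (ATnorm_nonneg' A)))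
  obtain ⟨u, hu⟩ := u
  obtain ⟨j, hj⟩ := Function.ne_iff.1 hu
  have hpos : 0 < norm2 u := (abs_pos.2 hj).trans_le (abs_le_norm2 u j)
  have hpos2 : 0 < ∑ i, (u i) ^ 2 := Real.sqrt_pos.1 hpos
  have hk := key_bound A _ _ hs hT u hpos
  have hf : 0 ≤ dotp u ((c - ∑ i, yh i • A i + νh • (1 : Matrix (Fin n) (Fin n) ℝ)).mulVec u) := by
    have := hfeas.dotProduct_mulVec_nonneg u
    simpa [dotp, dotProduct] using this
  set w := T.transpose.mulVec (T.mulVec yh)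
  have e : c - ∑ i, w i • A i + νh • (1 : Matrix (Fin n) (Fin n) ℝ) =
      (c - ∑ i, yh i • A i + νh • (1 : Matrix (Fin n) (Fin n) ℝ)) - ∑ i, (w - yh) i • A i := by
    simp only [Pi.sub_apply, sub_smul, Finset.sum_sub_distrib]
    abel
  have e2 : ∀ a b : Fin n → ℝ, dotp u (a - b) = dotp u a - dotp u b := by
    intro a b
    simp [dotp, mul_sub, Finset.sum_sub_distrib]
  rw [le_div_iff₀ hpos2, e, Matrix.sub_mulVec, e2]
  linarith
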